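/- arXiv:2505.06717 — 3 statements merged into one kernel-verified Lean document; each statement's English description precedes it below -/
import Mathlib

section
/- Let I be an SR instance with n ≥ 2 agents that is unsolvable. Then every stable partition of I contains at least 2 cycles of odd length if n is even, and at least 1 cycle of odd length if n is odd; moreover, in both cases every stable partition of I contains at least one cycle of odd length at least 3. -/
/-- An SR instance with `n` agents. `rank i j` is the position (starting at 1) of
agent `j` in agent `i`'s preference list; by convention `rank i i = n`, encoding
that an agent prefers every other agent to itself. -/
structure SRInstance (n : ℕ) where
  rank : Fin n → Fin n → ℕ
  rank_self : ∀ i, rank i i = n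
  rank_bijOn : ∀ i, Set.BijOn (rank i) {j | j ≠ i} (Set.Icc 1 (n - 1))

variable {n : ℕ}

/-- `M` is a matching, encoded as an involution; `M i = i` means `i` is unmatched. -/
def IsMatching (M : Fin n → Fin n) : Prop := ∀ i, M (M i) = i

/-- The pair `{i, j}` blocks the matching `M`. -/
def Blocks (I : SRInstance n) (M : Fin n → Fin n) (i j : Fin n) : Prop :=
  i ≠ j ∧ (M i = i ∨ I.rank i j < I.rank i (M i)) ∧ (M j = j ∨ I.rank j i < I.rank j (M j))

def IsStableMatching (I : SRInstance n) (M : Fin n → Fin n) : Prop :=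
  IsMatching M ∧ ∀ i j, ¬ Blocks I M i j

def Solvable (I : SRInstance n) : Prop := ∃ M, IsStableMatching I M

/-- A stable partition: (T1) every agent weakly prefers its successor to its
predecessor, and (T2) no two distinct agents each strictly prefer the other to
their respective predecessors. -/
def IsStablePartition (I : SRInstance n) (σ : Equiv.Perm (Fin n)) : Prop :=
  (∀ a, I.rank a (σ a) ≤ I.rank a (σ⁻¹ a)) ∧
  ¬ ∃ i j : Fin n, i ≠ j ∧ I.rank i j < I.rank i (σ⁻¹ i) ∧ I.rank j i < I.rank j (σ⁻¹ j)

/-- The orbit (cycle) of `σ` containing `a`, as a finset. -/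
def orbitOf (σ : Equiv.Perm (Fin n)) (a : Fin n) : Finset (Fin n) :=
  Finset.univ.filter (fun b => σ.SameCycle a b)

/-- The number of cycles of odd length of the permutation `σ`. -/
def oddCycleCount (σ : Equiv.Perm (Fin n)) : ℕ :=
  ((Finset.univ.image (fun a => orbitOf σ a)).filter (fun s => Odd s.card)).card

/-- The cycle of `σ` at `a`, recorded as its orbit together with the cyclic
permutation induced on it (identity off the orbit). -/
def cycleAt (σ : Equiv.Perm (Fin n)) (a : Fin n) : Finset (Fin n) × Equiv.Perm (Fin n) :=
  (orbitOf σ a, σ.cycleOf a)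

/-- The stable cycles of `I`: cycles occurring in some stable partition of `I`. -/
def stableCycles (I : SRInstance n) : Set (Finset (Fin n) × Equiv.Perm (Fin n)) :=
  {c | ∃ (σ : Equiv.Perm (Fin n)) (a : Fin n), IsStablePartition I σ ∧ cycleAt σ a = c}

/-- The reduced stable cycles of `I`: stable cycles of length 2 or of odd length. -/
def reducedStableCycles (I : SRInstance n) : Set (Finset (Fin n) × Equiv.Perm (Fin n)) :=
  {c | c ∈ stableCycles I ∧ (c.1.card = 2 ∨ Odd c.1.card)}

open Equiv.Perm in
lemma orbitOf_eq_support_cycleOf (σ : Equiv.Perm (Fin n)) {a : Fin n} (ha : σ a ≠ a) :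
    orbitOf σ a = (σ.cycleOf a).support := by
  ext b
  rw [mem_support_cycleOf_iff' ha]
  simp [orbitOf]

lemma orbitOf_eq_orbitOf_iff (σ : Equiv.Perm (Fin n)) (a b : Fin n) :
    orbitOf σ b = orbitOf σ a ↔ σ.SameCycle a b := by
  constructor
  · intro h
    have hb : b ∈ orbitOf σ b := by simp [orbitOf, Equiv.Perm.SameCycle.refl]
    rw [h] at hb
    simpa [orbitOf] using hb
  · intro h
    ext c
    simp only [orbitOf, Finset.mem_filter, Finset.mem_univ, true_and]
    exact ⟨h.trans, h.symm.trans⟩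

lemma two_le_card_orbitOf (σ : Equiv.Perm (Fin n)) {a : Fin n} (ha : σ a ≠ a) :
    2 ≤ (orbitOf σ a).card := by
  rw [orbitOf_eq_support_cycleOf σ ha]
  exact (Equiv.Perm.isCycle_cycleOf σ ha).two_le_card_support

/-- The number of odd cycles has the same parity as the number of points. -/
lemma odd_oddCycleCount_iff (σ : Equiv.Perm (Fin n)) : Odd (oddCycleCount σ) ↔ Odd n := by
  have key : n = ∑ s ∈ Finset.univ.image (orbitOf σ), s.card := by
    conv_lhs => rw [← Fintype.card_fin n, ← Finset.card_univ,
      Finset.card_eq_sum_card_image (orbitOf σ)]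
    refine Finset.sum_congr rfl fun s hs => ?_
    obtain ⟨a, -, rfl⟩ := Finset.mem_image.mp hs
    congr 1
    ext b
    simp only [Finset.mem_filter, Finset.mem_univ, true_and, orbitOf_eq_orbitOf_iff]
    simp [orbitOf]
  conv_rhs => rw [key]
  rw [Finset.odd_sum_iff_odd_card_odd]
  rfl

lemma pow_apply_eq_modEq_card_orbitOf (σ : Equiv.Perm (Fin n)) {a : Fin n} (ha : σ a ≠ a)
    {k l : ℕ} (h : (σ ^ k) a = (σ ^ l) a) : k ≡ l [MOD (orbitOf σ a).card] := by
  have hc := Equiv.Perm.isCycle_cycleOf σ ha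
  rw [orbitOf_eq_support_cycleOf σ ha, ← hc.orderOf, ← pow_eq_pow_iff_modEq, hc.pow_eq_pow_iff]
  exact ⟨a, by simpa using ha, by simpa using h⟩

/-- If every nontrivial cycle is even, the non-fixed points can be properly 2-coloured. -/
lemma exists_alternating_coloring (σ : Equiv.Perm (Fin n))
    (heven : ∀ a, σ a ≠ a → Even (orbitOf σ a).card) :
    ∃ c : Fin n → Prop, ∀ a, σ a ≠ a → (c (σ a) ↔ ¬ c a) := by
  let r : Fin n → Fin n := fun a => (Quotient.mk (Equiv.Perm.SameCycle.setoid σ) a).out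
  have hr : ∀ a, σ.SameCycle (r a) a := fun a =>
    Quotient.mk_out (s := Equiv.Perm.SameCycle.setoid σ) a
  have hrσ : ∀ a, r (σ a) = r a := fun a => by
    have : (Quotient.mk (Equiv.Perm.SameCycle.setoid σ) (σ a)) = Quotient.mk _ a :=
      Quotient.sound (Equiv.Perm.sameCycle_apply_left.mpr (Equiv.Perm.SameCycle.refl σ a))
    simp only [r, this]
  choose k hk using fun a => (hr a).exists_nat_pow_eq
  refine ⟨fun a => Even (k a), fun a ha => ?_⟩
  have hra : σ (r a) ≠ r a := fun h => ha ((hr a).apply_eq_self_iff.mp h)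
  have hpow : (σ ^ k (σ a)) (r a) = (σ ^ (k a + 1)) (r a) := by
    rw [← hrσ a, hk, hrσ a, pow_succ', Equiv.Perm.mul_apply, hk]
  have hmod := (pow_apply_eq_modEq_card_orbitOf σ hra hpow).of_dvd (heven _ hra).two_dvd
  rw [Nat.ModEq] at hmod
  simp only [Nat.even_iff]
  omega

namespace SRInstance

lemma rank_lt (I : SRInstance n) {i j : Fin n} (h : i ≠ j) : I.rank i j < n := by
  have := (I.rank_bijOn i).mapsTo (show j ∈ {j | j ≠ i} from h.symm)
  have := this.2
  have := i.pos
  omega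

end SRInstance

/-- Splitting the even cycles of a stable partition into pairs gives a stable matching. -/
lemma IsStablePartition.solvable_of_even {I : SRInstance n} {σ : Equiv.Perm (Fin n)}
    (hσ : IsStablePartition I σ) (heven : ∀ a, σ a ≠ a → Even (orbitOf σ a).card) :
    Solvable I := by
  classical
  obtain ⟨c, hc⟩ := exists_alternating_coloring σ heven
  have hinv : ∀ a, σ a ≠ a → (c (σ⁻¹ a) ↔ ¬ c a) := fun a ha => by
    have h := hc (σ⁻¹ a) (by
      simpa using fun h : a = σ⁻¹ a => ha (by conv_lhs => rw [h]; simp))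
    rw [show σ (σ⁻¹ a) = a from σ.apply_symm_apply a] at h
    tauto
  let M : Fin n → Fin n := fun a => if c a then σ a else σ⁻¹ a
  have hM : ∀ i, I.rank i (M i) ≤ I.rank i (σ⁻¹ i) := fun i => by
    by_cases h : c i
    · simpa [M, h] using hσ.1 i
    · simp [M, h]
  have hfix : ∀ i, M i = i → σ⁻¹ i = i := fun i hi => by
    by_cases h : c i
    · rw [Equiv.Perm.inv_eq_iff_eq]
      simpa [M, h] using hi.symm
    · simpa [M, h] using hi
  have himp : ∀ i j, i ≠ j → (M i = i ∨ I.rank i j < I.rank i (M i)) →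
      I.rank i j < I.rank i (σ⁻¹ i) := by
    rintro i j hij (h | h)
    · rw [hfix i h, I.rank_self]
      exact I.rank_lt hij
    · exact h.trans_le (hM i)
  refine ⟨M, fun i => ?_, fun i j h => ?_⟩
  · by_cases hi : σ i = i
    · have hi' : σ⁻¹ i = i := Equiv.Perm.inv_eq_iff_eq.mpr hi.symm
      have : M i = i := by simp only [M, hi, hi', ite_self]
      rw [this, this]
    · by_cases h : c i
      · have h' : ¬ c (σ i) := by rw [hc i hi]; exact not_not.mpr h
        simp [M, h, h']
      · have h' : c (σ⁻¹ i) := (hinv i hi).mpr h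
        simp only [M, h, h', if_true, if_false]
        exact σ.apply_symm_apply i
  · exact hσ.2 ⟨i, j, h.1, himp i j h.1 h.2.1, himp j i h.1.symm h.2.2⟩

/-- If an SR instance with `n ≥ 2` agents is unsolvable, then every
stable partition has at least 2 odd cycles when `n` is even and at least 1 when
`n` is odd, and in both cases it contains a cycle of odd length at least 3. -/
theorem unsolvable_stable_partition_odd_cycles {n : ℕ} (hn : 2 ≤ n) (I : SRInstance n)
    (hunsolv : ¬ Solvable I) (σ : Equiv.Perm (Fin n)) (hσ : IsStablePartition I σ) :
    (Even n → 2 ≤ oddCycleCount σ) ∧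
    (Odd n → 1 ≤ oddCycleCount σ) ∧
    (∃ a : Fin n, Odd (orbitOf σ a).card ∧ 3 ≤ (orbitOf σ a).card) := by
  obtain ⟨a, hodd, hcard⟩ : ∃ a : Fin n, Odd (orbitOf σ a).card ∧ 3 ≤ (orbitOf σ a).card := by
    by_contra! h
    refine hunsolv (hσ.solvable_of_even fun a ha => ?_)
    by_contra hne
    rw [Nat.not_even_iff_odd] at hne
    have h3 := h a hne
    have h2 := two_le_card_orbitOf σ ha
    rw [Nat.odd_iff] at hne
    omega
  have hpos : 1 ≤ oddCycleCount σ := Finset.card_pos.mpr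
    ⟨orbitOf σ a, Finset.mem_filter.mpr ⟨Finset.mem_image_of_mem _ (Finset.mem_univ a), hodd⟩⟩
  refine ⟨fun hn => ?_, fun _ => hpos, a, hodd, hcard⟩
  have hpar := odd_oddCycleCount_iff σ
  rw [Nat.odd_iff, Nat.odd_iff] at hpar
  rw [Nat.even_iff] at hn
  omega
end

section
/- For every even n ≥ 6, there exists an unsolvable SR instance with n agents that admits a stable partition containing exactly 2 cycles of odd length (one cycle of length 3 and one fixed point). -/
variable {n : ℕ}

theorem SRInstance.one_le_rank (I : SRInstance n) (i j : Fin n) : 1 ≤ I.rank i j := by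
  by_cases h : j = i
  · subst h
    rw [I.rank_self]
    exact Fin.pos j
  · exact ((I.rank_bijOn i).mapsTo h).1

theorem SRInstance.rank_injective (I : SRInstance n) (i : Fin n) :
    Function.Injective (I.rank i) := by
  have off_diag (j : Fin n) (h : j ≠ i) : I.rank i j ≠ I.rank i i := by
    have h₁ := (I.rank_bijOn i).mapsTo h
    have h₂ := I.rank_self i
    have h₃ := Fin.pos i
    simp only [Set.mem_Icc] at h₁
    omega
  intro j k hjk
  by_cases hj : j = i
  · subst hj
    by_contra hk
    exact off_diag k (Ne.symm hk) hjk.symm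
  · by_cases hk : k = i
    · subst hk
      exact absurd hjk (off_diag j hj)
    · exact (I.rank_bijOn i).injOn hj hk hjk

theorem exists_perm_apply_eq_three {α : Type*} {a b c a' b' c' : α} (hab : a ≠ b) (hac : a ≠ c)
    (hbc : b ≠ c) (hab' : a' ≠ b') (hac' : a' ≠ c') (hbc' : b' ≠ c') :
    ∃ e : Equiv.Perm α, e a = a' ∧ e b = b' ∧ e c = c' := by
  classical
  refine ⟨(Equiv.swap a a').trans ((Equiv.swap (Equiv.swap a a' b) b').trans
    (Equiv.swap (Equiv.swap (Equiv.swap a a' b) b' (Equiv.swap a a' c)) c')), ?_, ?_, ?_⟩ <;>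
  simp only [Equiv.trans_apply, Equiv.swap_apply_def] <;> grind

/-- Preferences with a prescribed first and second choice for every agent. -/
theorem SRInstance.exists_rank_eq_one_two (h3 : 3 ≤ n) (p q : Fin n → Fin n)
    (hp : ∀ i, p i ≠ i) (hq : ∀ i, q i ≠ i) (hpq : ∀ i, p i ≠ q i) :
    ∃ I : SRInstance n, ∀ i, I.rank i (p i) = 1 ∧ I.rank i (q i) = 2 := by
  have perms (i : Fin n) : ∃ e : Equiv.Perm (Fin n), e (p i) = ⟨0, by omega⟩ ∧
      e (q i) = ⟨1, by omega⟩ ∧ e i = ⟨n - 1, by omega⟩ := by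
    apply exists_perm_apply_eq_three (hpq i) (hp i) (hq i) <;>
      simp only [ne_eq, Fin.mk.injEq] <;> omega
  choose e he₁ he₂ he₃ using perms
  refine ⟨⟨fun i j => (e i j : ℕ) + 1, fun i => ?_, fun i => ⟨fun j hj => ?_,
    fun j _ k _ hjk => ?_, fun m hm => ?_⟩⟩, fun i => ?_⟩
  · simp only [he₃]
    omega
  · have hne : (e i j : ℕ) ≠ n - 1 := by
      intro h
      exact hj ((e i).injective (Fin.ext (by rw [h, he₃])))
    have hlt := (e i j).isLt
    simp only [Set.mem_Icc]
    omega
  · exact (e i).injective (Fin.ext (by simpa using hjk))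
  · simp only [Set.mem_Icc] at hm
    refine ⟨(e i).symm ⟨m - 1, by omega⟩, ?_, by simp; omega⟩
    intro h
    have := (he₃ i).symm.trans ((Equiv.symm_apply_eq _).mp h).symm
    simp only [Fin.mk.injEq] at this
    omega
  · simp [he₁, he₂]

theorem orbitOf_eq_of_closed (σ : Equiv.Perm (Fin n)) (a : Fin n) (s : Finset (Fin n))
    (ha : a ∈ s) (closed : ∀ x ∈ s, σ x ∈ s) (reach : ∀ x ∈ s, σ.SameCycle a x) :
    orbitOf σ a = s := by
  ext b
  simp only [orbitOf, Finset.mem_filter, Finset.mem_univ, true_and]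
  refine ⟨fun h => ?_, reach b⟩
  obtain ⟨k, -, rfl⟩ := h.exists_pow_eq'
  induction k with
  | zero => simpa
  | succ k ih =>
    rw [pow_succ', Equiv.Perm.mul_apply]
    exact closed _ (ih ⟨k, by simp⟩)

/-- The permutation `(0 1 2)(3)(4 5)(6 7)⋯` of `Fin n`, for `n` even. -/
def triangleAndPairs (hn : Even n) (h6 : 6 ≤ n) : Equiv.Perm (Fin n) where
  toFun i := ⟨if i.val = 2 then 0 else if i.val < 2 then i.val + 1 else if i.val = 3 then 3 else
    if i.val % 2 = 0 then i.val + 1 else i.val - 1, by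
      have := i.isLt
      have := Nat.even_iff.mp hn
      split_ifs <;> omega⟩
  invFun i := ⟨if i.val = 0 then 2 else if i.val < 3 then i.val - 1 else if i.val = 3 then 3 else
    if i.val % 2 = 0 then i.val + 1 else i.val - 1, by
      have := i.isLt
      have := Nat.even_iff.mp hn
      split_ifs <;> omega⟩
  left_inv i := by
    apply Fin.ext
    dsimp only
    grind
  right_inv i := by
    apply Fin.ext
    dsimp only
    grind

section triangleAndPairs

variable (hn : Even n) (h6 : 6 ≤ n)

theorem triangleAndPairs_val (i : Fin n) : (triangleAndPairs hn h6 i).val =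
    if i.val = 2 then 0 else if i.val < 2 then i.val + 1 else if i.val = 3 then 3 else
      if i.val % 2 = 0 then i.val + 1 else i.val - 1 := rfl

theorem triangleAndPairs_inv_val (i : Fin n) : ((triangleAndPairs hn h6)⁻¹ i).val =
    if i.val = 0 then 2 else if i.val < 3 then i.val - 1 else if i.val = 3 then 3 else
      if i.val % 2 = 0 then i.val + 1 else i.val - 1 := rfl

theorem orbitOf_triangleAndPairs_of_lt (a : Fin n) (ha : a.val < 3) :
    orbitOf (triangleAndPairs hn h6) a =
      {⟨0, by omega⟩, ⟨1, by omega⟩, ⟨2, by omega⟩} := by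
  have sq : (triangleAndPairs hn h6 (triangleAndPairs hn h6 a)).val = (a.val + 2) % 3 := by
    simp only [triangleAndPairs_val]
    grind
  have step := triangleAndPairs_val hn h6 a
  apply orbitOf_eq_of_closed
  · simp only [Finset.mem_insert, Finset.mem_singleton, Fin.ext_iff]
    omega
  · intro x hx
    simp only [Finset.mem_insert, Finset.mem_singleton, Fin.ext_iff] at hx ⊢
    rw [triangleAndPairs_val]
    split_ifs <;> omega
  · intro x hx
    have hx3 : x = a ∨ x = triangleAndPairs hn h6 a ∨
        x = triangleAndPairs hn h6 (triangleAndPairs hn h6 a) := by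
      simp only [Finset.mem_insert, Finset.mem_singleton, Fin.ext_iff] at hx ⊢
      split_ifs at step <;> omega
    rcases hx3 with rfl | rfl | rfl <;> simp [Equiv.Perm.SameCycle.refl]

theorem orbitOf_triangleAndPairs_three :
    orbitOf (triangleAndPairs hn h6) ⟨3, by omega⟩ = {⟨3, by omega⟩} := by
  apply orbitOf_eq_of_closed
  · simp
  · simp only [Finset.mem_singleton]
    rintro _ rfl
    simp [Fin.ext_iff, triangleAndPairs_val]
  · simp [Equiv.Perm.SameCycle.refl]

theorem card_orbitOf_triangleAndPairs_of_lt (a : Fin n) (ha : a.val < 3) :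
    (orbitOf (triangleAndPairs hn h6) a).card = 3 := by
  rw [orbitOf_triangleAndPairs_of_lt hn h6 a ha]
  rw [Finset.card_eq_three]
  exact ⟨_, _, _, by simp, by simp, by simp, rfl⟩

theorem card_orbitOf_triangleAndPairs_of_gt (a : Fin n) (ha : 3 < a.val) :
    (orbitOf (triangleAndPairs hn h6) a).card = 2 := by
  have step := triangleAndPairs_val hn h6 a
  have sq : triangleAndPairs hn h6 (triangleAndPairs hn h6 a) = a := by
    apply Fin.ext
    simp only [triangleAndPairs_val]
    grind
  rw [orbitOf_eq_of_closed _ a {a, triangleAndPairs hn h6 a} (by simp)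
    (by simp [sq]) (by simp [Equiv.Perm.SameCycle.refl])]
  apply Finset.card_pair
  intro h
  rw [← h] at step
  split_ifs at step <;> omega

theorem oddCycleCount_triangleAndPairs : oddCycleCount (triangleAndPairs hn h6) = 2 := by
  have card_three : (orbitOf (triangleAndPairs hn h6) ⟨3, by omega⟩).card = 1 := by
    rw [orbitOf_triangleAndPairs_three, Finset.card_singleton]
  have card_zero := card_orbitOf_triangleAndPairs_of_lt hn h6 ⟨0, by omega⟩ (by simp)
  have odd_orbits : (Finset.univ.image (fun a => orbitOf (triangleAndPairs hn h6) a)).filter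
      (fun s => Odd s.card) = {orbitOf (triangleAndPairs hn h6) ⟨0, by omega⟩,
        orbitOf (triangleAndPairs hn h6) ⟨3, by omega⟩} := by
    ext s
    simp only [Finset.mem_filter, Finset.mem_image, Finset.mem_univ, true_and,
      Finset.mem_insert, Finset.mem_singleton]
    constructor
    · rintro ⟨⟨a, rfl⟩, hodd⟩
      rcases lt_trichotomy a.val 3 with h | h | h
      · left
        rw [orbitOf_triangleAndPairs_of_lt hn h6 a h,
          orbitOf_triangleAndPairs_of_lt hn h6 ⟨0, by omega⟩ (by simp)]
      · right
        congr 1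
        exact Fin.ext h
      · rw [card_orbitOf_triangleAndPairs_of_gt hn h6 a h] at hodd
        exact absurd hodd (by decide)
    · rintro (rfl | rfl)
      · exact ⟨⟨_, rfl⟩, by rw [card_zero]; decide⟩
      · exact ⟨⟨_, rfl⟩, by rw [card_three]; decide⟩
  rw [oddCycleCount, odd_orbits]
  apply Finset.card_pair
  intro h
  rw [h, card_three] at card_zero
  omega

end triangleAndPairs

/-- Three agents whose top two choices are each other, in cyclic order, rule out a
stable matching. -/
theorem not_solvable_of_cyclic_triple (I : SRInstance n) (σ : Equiv.Perm (Fin n)) (a : Fin n)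
    (h_cube : σ (σ (σ a)) = a) (h_ne : σ a ≠ a) (first : ∀ i, σ.SameCycle a i → I.rank i (σ i) = 1)
    (second : ∀ i, σ.SameCycle a i → I.rank i (σ⁻¹ i) = 2) : ¬ Solvable I := by
  rintro ⟨M, hM, stable⟩
  have block (i : Fin n) (hi : σ.SameCycle a i) (hne : σ⁻¹ i ≠ i) (h₁ : M i ≠ σ i)
      (h₂ : M i ≠ σ⁻¹ i) : False := by
    have hfirst := first (σ⁻¹ i) (by simpa using hi)
    rw [Equiv.Perm.coe_inv, Equiv.apply_symm_apply, ← Equiv.Perm.coe_inv] at hfirst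
    refine stable i (σ⁻¹ i) ⟨hne.symm, Or.inr ?_, Or.inr ?_⟩
    · have := I.one_le_rank i (M i)
      have := (I.rank_injective i).ne h₁
      have := (I.rank_injective i).ne h₂
      have := first i hi
      have := second i hi
      omega
    · have hMj : M (σ⁻¹ i) ≠ i := fun h => h₂ (by rw [← hM (σ⁻¹ i), h])
      have := I.one_le_rank (σ⁻¹ i) (M (σ⁻¹ i))
      have := (I.rank_injective (σ⁻¹ i)).ne hMj
      omega
  have inv_a : σ⁻¹ a = σ (σ a) := by rw [Equiv.Perm.inv_eq_iff_eq, h_cube]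
  have h_ne₂ : σ (σ a) ≠ σ a := σ.injective.ne h_ne
  have h_ne₃ : a ≠ σ (σ a) := fun h => σ.injective.ne h_ne₂ (h_cube.trans h)
  have block₁ := block a (.refl _ _) (by rw [inv_a]; exact h_ne₃.symm)
  have block₂ := block (σ a) (by simp [Equiv.Perm.SameCycle.refl]) (by simpa using h_ne.symm)
  have block₃ := block (σ (σ a)) (by simp [Equiv.Perm.SameCycle.refl]) (by simpa using h_ne₂.symm)
  rw [inv_a] at block₁
  simp only [Equiv.Perm.coe_inv, Equiv.symm_apply_apply, h_cube] at block₂ block₃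
  have M₁ := hM a
  have M₂ := hM (σ a)
  have M₃ := hM (σ (σ a))
  grind

/-- For every even `n ≥ 6` there is an unsolvable SR instance with
`n` agents that admits a stable partition with exactly 2 odd cycles: one cycle
of length 3 and one fixed point. -/
theorem exists_unsolvable_even_two_odd_cycles (n : ℕ) (hn : Even n) (h6 : 6 ≤ n) :
    ∃ I : SRInstance n, ¬ Solvable I ∧
      ∃ σ : Equiv.Perm (Fin n), IsStablePartition I σ ∧ oddCycleCount σ = 2 ∧
        (∃ a : Fin n, (orbitOf σ a).card = 3) ∧ (∃ b : Fin n, σ b = b) := by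
  have σ_val := triangleAndPairs_val hn h6
  have σ_inv_val := triangleAndPairs_inv_val hn h6
  have σ_odd := oddCycleCount_triangleAndPairs hn h6
  have σ_orbit := orbitOf_triangleAndPairs_of_lt hn h6 ⟨0, by omega⟩ (by simp)
  have σ_card := card_orbitOf_triangleAndPairs_of_lt hn h6 ⟨0, by omega⟩ (by simp)
  generalize triangleAndPairs hn h6 = σ at *
  have σ_three : σ ⟨3, by omega⟩ = ⟨3, by omega⟩ := Fin.ext (by simp [σ_val])
  obtain ⟨I, hI⟩ := SRInstance.exists_rank_eq_one_two (n := n) (by omega)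
    (fun i => if i.val = 3 then ⟨0, by omega⟩ else σ i)
    (fun i => if i.val < 3 then σ⁻¹ i else if i.val = 3 then ⟨1, by omega⟩ else ⟨0, by omega⟩)
    (fun i => by
      have := σ_val i
      rw [ne_eq, Fin.ext_iff]
      grind)
    (fun i => by
      have := σ_inv_val i
      rw [ne_eq, Fin.ext_iff]
      grind)
    (fun i => by
      have := σ_val i
      have := σ_inv_val i
      rw [ne_eq, Fin.ext_iff]
      grind)
  have first (i : Fin n) (h : i.val ≠ 3) : I.rank i (σ i) = 1 := by
    simpa [h] using (hI i).1
  have second (i : Fin n) (h : i.val < 3) : I.rank i (σ⁻¹ i) = 2 := by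
    simpa [h] using (hI i).2
  have small (i : Fin n) (h : σ.SameCycle ⟨0, by omega⟩ i) : i.val < 3 := by
    have mem : i ∈ orbitOf σ ⟨0, by omega⟩ := by simpa [orbitOf] using h
    rw [σ_orbit] at mem
    simp only [Finset.mem_insert, Finset.mem_singleton, Fin.ext_iff] at mem
    omega
  refine ⟨I, ?_, σ, ⟨fun i => ?_, ?_⟩, σ_odd, ⟨_, σ_card⟩, _, σ_three⟩
  · refine not_solvable_of_cyclic_triple I σ ⟨0, by omega⟩ (Fin.ext (by simp [σ_val]))
      (by simp [Fin.ext_iff, σ_val]) (fun i hi => first i ?_) (fun i hi => second i (small i hi))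
    have := small i hi
    omega
  · by_cases h : i.val = 3
    · have σ_fix : σ i = i := by rw [show i = ⟨3, by omega⟩ from Fin.ext h, σ_three]
      rw [Equiv.Perm.inv_eq_iff_eq.mpr σ_fix.symm, σ_fix]
    · rw [first i h]
      exact I.one_le_rank _ _
  · rintro ⟨i, j, hij, h₁, h₂⟩
    have choice (i j : Fin n) (h : I.rank i j < I.rank i (σ⁻¹ i)) :
        i.val = 3 ∨ i.val < 3 ∧ j = σ i := by
      rcases lt_trichotomy i.val 3 with hi | hi | hi
      · right
        refine ⟨hi, I.rank_injective i ?_⟩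
        have := I.one_le_rank i j
        rw [second i hi] at h
        rw [first i (by omega)]
        omega
      · exact Or.inl hi
      · have inv_eq : σ⁻¹ i = σ i := by
          apply Fin.ext
          rw [σ_val, σ_inv_val]
          split_ifs <;> omega
        rw [inv_eq, first i (by omega)] at h
        have := I.one_le_rank i j
        omega
    have σ_lt (i : Fin n) (h : i.val < 3) : (σ i).val = (i.val + 1) % 3 := by
      rw [σ_val]
      split_ifs <;> omega
    have hi := choice i j h₁
    have hj := choice j i h₂
    have val_i := σ_lt i
    have val_j := σ_lt j
    simp only [ne_eq, Fin.ext_iff] at hij hi hj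
    omega
end

section
/- Let I be an SR instance and let SC(I) and RSC(I) denote its sets of stable cycles and reduced stable cycles, respectively. Then |RSC(I)| ≤ |SC(I)| ≤ 3·|RSC(I)|. -/
variable {n : ℕ}

namespace SRInstance

variable (I : SRInstance n)

theorem rank_lt_rank_self {i j : Fin n} (hj : j ≠ i) : I.rank i j < I.rank i i := by
  have h := (I.rank_bijOn i).mapsTo (show j ∈ {j | j ≠ i} from hj)
  rw [Set.mem_Icc] at h
  have := I.rank_self i
  have := i.pos
  omega

theorem rank_le_rank_self (i j : Fin n) : I.rank i j ≤ I.rank i i := by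
  by_cases hj : j = i
  · rw [hj]
  · exact (I.rank_lt_rank_self hj).le

theorem rank_injective_s17 (i : Fin n) : Function.Injective (I.rank i) := by
  intro j k h
  by_cases hj : j = i <;> by_cases hk : k = i
  · rw [hj, hk]
  · have := I.rank_lt_rank_self hk
    subst hj
    omega
  · have := I.rank_lt_rank_self hj
    subst hk
    omega
  · exact (I.rank_bijOn i).injOn hj hk h

/-- The number of the two neighbours `σ u` and `σ⁻¹ u` that `u` weakly prefers to `v`. -/
def weakCount (σ : Equiv.Perm (Fin n)) (u v : Fin n) : ℤ :=
  (if I.rank u (σ u) ≤ I.rank u v then 1 else 0) +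
    (if I.rank u (σ⁻¹ u) ≤ I.rank u v then 1 else 0)

/-- The total weight dominating the pair `{u, v}` in the half-integral matching given by `σ`
(scaled by two). -/
def dominance (σ : Equiv.Perm (Fin n)) (u v : Fin n) : ℤ :=
  I.weakCount σ u v + I.weakCount σ v u -
    ((if σ u = v then 1 else 0) + (if σ v = u then 1 else 0))

variable {I} {σ τ : Equiv.Perm (Fin n)}

theorem two_le_dominance (hσ : IsStablePartition I σ) (u v : Fin n) :
    2 ≤ I.dominance σ u v := by
  have hu := hσ.1 u
  have hv := hσ.1 v
  unfold dominance weakCount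
  by_cases huv : u = v
  · subst huv
    simp only [I.rank_le_rank_self, if_true]
    split_ifs <;> norm_num
  · have hblock : ¬ (I.rank u v < I.rank u (σ⁻¹ u) ∧ I.rank v u < I.rank v (σ⁻¹ v)) :=
      fun h => hσ.2 ⟨u, v, huv, h⟩
    have e1 : σ u = v → I.rank u (σ u) = I.rank u v ∧ I.rank v (σ⁻¹ v) = I.rank v u := by
      rintro rfl
      simp
    have e2 : σ v = u → I.rank v (σ v) = I.rank v u ∧ I.rank u (σ⁻¹ u) = I.rank u v := by
      rintro rfl
      simp
    split_ifs <;> grind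

theorem sum_dominance_add (I : SRInstance n) (σ τ : Equiv.Perm (Fin n)) :
    ∑ u, (I.dominance σ u (τ u) + I.dominance τ u (σ u)) = ∑ _u : Fin n, 4 := by
  have reindex : ∀ (ρ : Equiv.Perm (Fin n)) (f : Fin n → Fin n → ℤ),
      ∑ u, f (ρ u) u = ∑ u, f u (ρ⁻¹ u) := fun ρ f => by
    rw [← Equiv.sum_comp ρ (fun u => f u (ρ⁻¹ u))]
    simp
  have hpair : ∀ (u v w : Fin n),
      ((if I.rank u v ≤ I.rank u w then 1 else 0) + (if I.rank u w ≤ I.rank u v then 1 else 0) : ℤ)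
        = 1 + if v = w then 1 else 0 := fun u v w => by
    by_cases h : v = w
    · simp [h]
    · have := (I.rank_injective_s17 u).ne h
      split_ifs <;> grind
  have hpt : ∀ u, I.weakCount σ u (τ u) + I.weakCount σ u (τ⁻¹ u) +
      (I.weakCount τ u (σ u) + I.weakCount τ u (σ⁻¹ u)) =
      4 + ((if σ u = τ u then 1 else 0) + (if σ⁻¹ u = τ⁻¹ u then 1 else 0) +
        (if σ u = τ⁻¹ u then 1 else 0) + (if σ⁻¹ u = τ u then 1 else 0)) := fun u => by
    have h1 := hpair u (σ u) (τ u)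
    have h2 := hpair u (σ⁻¹ u) (τ⁻¹ u)
    have h3 := hpair u (σ u) (τ⁻¹ u)
    have h4 := hpair u (σ⁻¹ u) (τ u)
    unfold weakCount
    linarith
  have hsum := Finset.sum_congr (rfl : (Finset.univ : Finset (Fin n)) = _) fun u _ => hpt u
  have r1 := reindex τ (I.weakCount σ)
  have r2 := reindex σ (I.weakCount τ)
  have r3 : ∑ u, (if σ⁻¹ u = τ⁻¹ u then 1 else 0 : ℤ) = ∑ u, (if τ u = σ u then 1 else 0) := by
    rw [← reindex τ (fun u v => if σ⁻¹ u = v then 1 else 0)]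
    simp only [Equiv.Perm.inv_eq_iff_eq]
  have r4 : ∑ u, (if σ u = τ⁻¹ u then 1 else 0 : ℤ) = ∑ u, (if τ (σ u) = u then 1 else 0) := by
    simp only [Equiv.Perm.eq_inv_iff_eq]
  have r5 : ∑ u, (if σ⁻¹ u = τ u then 1 else 0 : ℤ) = ∑ u, (if σ (τ u) = u then 1 else 0) := by
    refine Finset.sum_congr rfl fun u _ => ?_
    exact if_congr (Equiv.Perm.inv_eq_iff_eq.trans eq_comm) rfl rfl
  simp only [dominance, Finset.sum_add_distrib, Finset.sum_sub_distrib] at hsum ⊢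
  linarith

theorem dominance_eq_two (hσ : IsStablePartition I σ) (hτ : IsStablePartition I τ) (u : Fin n) :
    I.dominance σ u (τ u) = 2 := by
  have hle : ∀ v ∈ Finset.univ, (4 : ℤ) ≤ I.dominance σ v (τ v) + I.dominance τ v (σ v) :=
    fun v _ => by linarith [two_le_dominance hσ v (τ v), two_le_dominance hτ v (σ v)]
  have h := (Finset.sum_eq_sum_iff_of_le hle).1 (sum_dominance_add I σ τ).symm u (Finset.mem_univ u)
  linarith [two_le_dominance hσ u (τ u), two_le_dominance hτ u (σ u)]

/-- If `d` prefers its `τ`-predecessor to its `σ`-predecessor, then so does the agent two steps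
before `d` along `σ`, provided it does not lie on a cycle of length at most two. -/
theorem rank_inv_lt_step (hσ : IsStablePartition I σ) (hτ : IsStablePartition I τ)
    {d x e : Fin n} (hxd : σ x = d) (hex : σ e = x) (he : σ x ≠ e) (he' : σ e ≠ σ⁻¹ e)
    (h : I.rank d (τ⁻¹ d) < I.rank d x) : I.rank e (τ⁻¹ e) < I.rank e (σ⁻¹ e) := by
  have hxd' : σ⁻¹ d = x := by rw [← hxd]; simp
  have hex' : σ⁻¹ x = e := by rw [← hex]; simp
  have hd1 := hτ.1 d
  have hx1 := hτ.1 x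
  have hx2 := hσ.1 x
  have he1 := hτ.1 e
  have he2 : I.rank e x < I.rank e (σ⁻¹ e) := by
    have := hσ.1 e
    have := (I.rank_injective_s17 e).ne he'
    rw [hex] at *
    omega
  have hxw : I.rank x d < I.rank x (τ x) := by
    have h2 := dominance_eq_two hτ hσ x
    rw [hxd] at h2
    have n1 : τ x ≠ d := by
      rintro rfl
      simp at h
    have n2 : τ d ≠ x := by
      rintro rfl
      omega
    unfold dominance weakCount at h2
    rw [if_neg n1, if_neg n2] at h2
    split_ifs at h2 <;> grind
  have hxe : I.rank x e ≤ I.rank x (τ x) := by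
    by_contra! hlt
    have h2 := dominance_eq_two hσ hτ x
    have n1 : σ x ≠ τ x := by
      intro hc
      rw [← hc, hxd] at hxw
      omega
    have n2 : σ (τ x) ≠ x := by
      intro hc
      have : τ x = e := by rw [← hex', Equiv.Perm.eq_inv_iff_eq, hc]
      rw [this] at hlt
      omega
    have n3 : x ≠ τ x := by
      intro hc
      rw [← hc] at hlt
      exact hlt.not_ge (I.rank_le_rank_self x e)
    have hw := hσ.1 (τ x)
    have hblock : ¬ (I.rank x (τ x) < I.rank x (σ⁻¹ x) ∧
        I.rank (τ x) x < I.rank (τ x) (σ⁻¹ (τ x))) := fun h => hσ.2 ⟨x, τ x, n3, h⟩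
    unfold dominance weakCount at h2
    rw [if_neg n1, if_neg n2] at h2
    rw [hex', hxd] at *
    split_ifs at h2 <;> grind
  have hfin : I.rank e (τ⁻¹ e) ≤ I.rank e x := by
    rcases hxe.eq_or_lt with heq | hlt
    · have : τ x = e := ((I.rank_injective_s17 x) heq).symm
      rw [← this]
      simp
    · have h2 := dominance_eq_two hτ hσ e
      rw [hex] at h2
      have n1 : τ e ≠ x := by
        rintro rfl
        simp at hx1
        omega
      have n2 : τ x ≠ e := by
        intro hc
        rw [hc] at hlt
        omega
      unfold dominance weakCount at h2
      rw [if_neg n1, if_neg n2] at h2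
      split_ifs at h2 <;> grind
  omega

theorem isCycleOn_orbitOf (σ : Equiv.Perm (Fin n)) (a : Fin n) :
    σ.IsCycleOn (orbitOf σ a : Finset (Fin n)) := by
  have h : ((orbitOf σ a : Finset (Fin n)) : Set (Fin n)) = {b | σ.SameCycle a b} := by
    ext b
    simp [orbitOf]
  rw [h]
  exact ⟨σ.bijOn fun x => Equiv.Perm.sameCycle_apply_right, fun x hx y hy => hx.symm.trans hy⟩

theorem mem_orbitOf_self (σ : Equiv.Perm (Fin n)) (a : Fin n) : a ∈ orbitOf σ a := by
  simp [orbitOf, Equiv.Perm.SameCycle.refl]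

theorem orbitOf_inv_apply (σ : Equiv.Perm (Fin n)) (a : Fin n) :
    orbitOf σ (σ⁻¹ a) = orbitOf σ a := by
  ext b
  simp [orbitOf]

/-- On an even cycle of `σ` of length at least four, two stable partitions agreeing on the
successor of `a` cannot have `a` prefer its `σ`-predecessor to its `τ`-predecessor. -/
theorem rank_inv_le_of_apply_eq (hσ : IsStablePartition I σ) (hτ : IsStablePartition I τ)
    {a : Fin n} (hab : σ a = τ a) (heven : Even (orbitOf σ a).card)
    (htwo : (orbitOf σ a).card ≠ 2) : I.rank a (τ⁻¹ a) ≤ I.rank a (σ⁻¹ a) := by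
  by_contra! hlt
  have hC := isCycleOn_orbitOf σ a
  have ha := mem_orbitOf_self σ a
  have hpos : 0 < (orbitOf σ a).card := Finset.card_pos.2 ⟨a, ha⟩
  have hmem : ∀ k : ℕ, (σ⁻¹ ^ k) a ∈ orbitOf σ a := fun k => by
    rw [orbitOf, Finset.mem_filter_univ]
    exact Equiv.Perm.sameCycle_inv.1 (Equiv.Perm.sameCycle_pow_right.2 (.refl _ _))
  have hsq : ∀ y ∈ orbitOf σ a, σ y ≠ σ⁻¹ y := by
    intro y hy hc
    have h2 : (σ ^ 2) y = y := by
      rw [pow_two, Equiv.Perm.mul_apply, hc]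
      simp
    have := Nat.le_of_dvd two_pos ((hC.pow_apply_eq hy).1 h2)
    obtain ⟨k, hk⟩ := heven
    omega
  have key : ∀ k : ℕ, I.rank ((σ⁻¹ ^ (2 * k + 1)) a) (τ⁻¹ ((σ⁻¹ ^ (2 * k + 1)) a)) <
      I.rank ((σ⁻¹ ^ (2 * k + 1)) a) (σ⁻¹ ((σ⁻¹ ^ (2 * k + 1)) a)) := by
    intro k
    induction k with
    | zero =>
      have hd : σ (σ⁻¹ a) = a := by simp
      have hne : a ≠ σ⁻¹ a := fun hc => hsq a ha (by
        have h1 : σ a = a := by conv_lhs => rw [hc]; simp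
        rw [h1, ← hc])
      have hblock : ¬ (I.rank a (σ⁻¹ a) < I.rank a (τ⁻¹ a) ∧
          I.rank (σ⁻¹ a) a < I.rank (σ⁻¹ a) (τ⁻¹ (σ⁻¹ a))) := fun h => hτ.2 ⟨a, _, hne, h⟩
      have h1 := hσ.1 (σ⁻¹ a)
      have h2 := (I.rank_injective_s17 (σ⁻¹ a)).ne (hsq (σ⁻¹ a) (hmem 1))
      rw [hd] at h1 h2
      rw [mul_zero, zero_add, pow_one]
      omega
    | succ k ih =>
      set d := (σ⁻¹ ^ (2 * k + 1)) a with hd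
      have hde : (σ⁻¹ ^ (2 * (k + 1) + 1)) a = σ⁻¹ (σ⁻¹ d) := by
        rw [hd, show 2 * (k + 1) + 1 = (2 * k + 1) + 1 + 1 by ring, pow_succ', pow_succ']
        rfl
      have hm := hmem (2 * (k + 1) + 1)
      rw [hde] at hm ⊢
      have h1 : σ (σ⁻¹ d) = d := by simp
      have h2 : σ (σ⁻¹ (σ⁻¹ d)) = σ⁻¹ d := by simp
      refine rank_inv_lt_step hσ hτ h1 h2 ?_ (hsq _ hm) ih
      intro hc
      refine hsq (σ⁻¹ d) ?_ hc
      have := hmem (2 * k + 2)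
      rwa [show 2 * k + 2 = (2 * k + 1) + 1 by ring, pow_succ'] at this
  obtain ⟨k, hk⟩ := heven
  obtain ⟨m, rfl⟩ : ∃ m, k = m + 1 := ⟨k - 1, by omega⟩
  have hb : (σ⁻¹ ^ (2 * m + 1)) a = σ a := by
    have h1 : (σ ^ (2 * m + 2)) a = a := (hC.pow_apply_eq ha).2 ⟨1, by omega⟩
    rw [inv_pow, Equiv.Perm.inv_eq_iff_eq, ← Equiv.Perm.mul_apply, ← pow_succ, h1]
  have := key m
  rw [hb] at this
  rw [show τ⁻¹ (σ a) = a by rw [hab]; simp] at this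
  simp at this

theorem inv_apply_eq_of_apply_eq (hσ : IsStablePartition I σ) (hτ : IsStablePartition I τ)
    {a : Fin n} (hab : σ a = τ a) (hσe : Even (orbitOf σ a).card) (hσt : (orbitOf σ a).card ≠ 2)
    (hτe : Even (orbitOf τ a).card) (hτt : (orbitOf τ a).card ≠ 2) : σ⁻¹ a = τ⁻¹ a :=
  I.rank_injective_s17 a (le_antisymm (rank_inv_le_of_apply_eq hτ hσ hab.symm hτe hτt)
    (rank_inv_le_of_apply_eq hσ hτ hab hσe hσt))

/-- A stable cycle of even length at least four is determined by any one of its arcs. -/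
theorem cycleAt_eq_of_apply_eq (hσ : IsStablePartition I σ) (hτ : IsStablePartition I τ)
    {a : Fin n} (hab : σ a = τ a) (hσe : Even (orbitOf σ a).card) (hσt : (orbitOf σ a).card ≠ 2)
    (hτe : Even (orbitOf τ a).card) (hτt : (orbitOf τ a).card ≠ 2) :
    cycleAt σ a = cycleAt τ a := by
  have key : ∀ m : ℕ, (σ⁻¹ ^ m) a = (τ⁻¹ ^ m) a ∧ σ ((σ⁻¹ ^ m) a) = τ ((σ⁻¹ ^ m) a) ∧
      orbitOf σ ((σ⁻¹ ^ m) a) = orbitOf σ a ∧ orbitOf τ ((σ⁻¹ ^ m) a) = orbitOf τ a := by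
    intro m
    induction m with
    | zero => exact ⟨rfl, hab, rfl, rfl⟩
    | succ m ih =>
      obtain ⟨h1, h2, h3, h4⟩ := ih
      have h := inv_apply_eq_of_apply_eq hσ hτ h2 (by rwa [h3]) (by rwa [h3]) (by rwa [h4])
        (by rwa [h4])
      rw [pow_succ', pow_succ', Equiv.Perm.mul_apply, Equiv.Perm.mul_apply, ← h1]
      refine ⟨h, ?_, by rw [orbitOf_inv_apply, h3], by rw [h, orbitOf_inv_apply, h4]⟩
      conv_rhs => rw [h]
      simp
  have hsame : ∀ y, σ.SameCycle a y ↔ τ.SameCycle a y := by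
    intro y
    constructor <;> intro hy
    · obtain ⟨m, rfl⟩ := (Equiv.Perm.sameCycle_inv.2 hy).exists_nat_pow_eq
      rw [(key m).1]
      exact Equiv.Perm.sameCycle_inv.1 (Equiv.Perm.sameCycle_pow_right.2 (.refl _ _))
    · obtain ⟨m, rfl⟩ := (Equiv.Perm.sameCycle_inv.2 hy).exists_nat_pow_eq
      rw [← (key m).1]
      exact Equiv.Perm.sameCycle_inv.1 (Equiv.Perm.sameCycle_pow_right.2 (.refl _ _))
  refine Prod.ext ?_ (Equiv.ext fun y => ?_)
  · ext y
    simp [cycleAt, orbitOf, hsame]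
  · simp only [cycleAt, Equiv.Perm.cycleOf_apply, ← hsame]
    split_ifs with hy
    · obtain ⟨m, rfl⟩ := (Equiv.Perm.sameCycle_inv.2 hy).exists_nat_pow_eq
      exact (key m).2.1
    · rfl

/-- An even cycle of a stable partition can be replaced by the transpositions of alternate
consecutive agents, starting from any of its arcs. -/
theorem exists_isStablePartition_swap (hσ : IsStablePartition I σ) {a : Fin n}
    (heven : Even (orbitOf σ a).card) :
    ∃ ρ, IsStablePartition I ρ ∧ ρ a = σ a ∧ ρ (σ a) = a := by
  classical
  let E : Fin n → Prop := fun x => (σ ^ 2).SameCycle a x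
  have hC := isCycleOn_orbitOf σ a
  have ha := mem_orbitOf_self σ a
  have hE1 : ∀ x, E x → ¬ E (σ x) := by
    intro x hx hx'
    obtain ⟨i, rfl⟩ := hx
    obtain ⟨j, hj⟩ := hx'
    rw [← zpow_natCast, ← zpow_mul, ← zpow_mul, ← Equiv.Perm.mul_apply, ← zpow_one_add] at hj
    have h1 : (σ ^ (((2 : ℕ) : ℤ) * j - (1 + ((2 : ℕ) : ℤ) * i))) a = a := by
      rw [sub_eq_neg_add, zpow_add, Equiv.Perm.mul_apply, hj, zpow_neg,
        Equiv.Perm.inv_eq_iff_eq]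
    have h2 := (hC.zpow_apply_eq ha).1 h1
    obtain ⟨k, hk⟩ := heven
    rw [hk] at h2
    obtain ⟨c, hc⟩ := h2
    push_cast at hc
    have : (k + k : ℤ) * c = 2 * (k * c) := by ring
    omega
  have hE2 : ∀ x, E (σ (σ x)) ↔ E x := fun x => by
    have : σ (σ x) = (σ ^ 2) x := rfl
    simp only [E, this, Equiv.Perm.sameCycle_apply_right]
  have hE3 : ∀ x, E (σ x) ↔ E (σ⁻¹ x) := fun x => by
    have := hE2 (σ⁻¹ x)
    simpa using this
  let ρ : Equiv.Perm (Fin n) :=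
    { toFun := fun x => if E x then σ x else if E (σ x) then σ⁻¹ x else σ x
      invFun := fun x => if E x then σ x else σ⁻¹ x
      left_inv := fun x => by
        by_cases h1 : E x
        · simp [h1, hE1 x h1]
        · by_cases h2 : E (σ x)
          · have := (hE3 x).1 h2
            simp only [h1, h2, this, if_false, if_true]
            exact σ.apply_symm_apply x
          · simp [h1, h2]
      right_inv := fun x => by
        by_cases h1 : E x
        · simp [h1, hE1 x h1, (hE2 x).2 h1]
        · by_cases h2 : E (σ⁻¹ x) <;> simp [h1] }
  have hρ : ∀ x, ρ x = if E x then σ x else if E (σ x) then σ⁻¹ x else σ x := fun _ => rfl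
  have hρi : ∀ x, ρ⁻¹ x = if E x then σ x else σ⁻¹ x := fun _ => rfl
  have hle : ∀ x, I.rank x (ρ⁻¹ x) ≤ I.rank x (σ⁻¹ x) := fun x => by
    rw [hρi]
    split_ifs
    · exact hσ.1 x
    · rfl
  have hEa : E a := Equiv.Perm.SameCycle.refl _ _
  refine ⟨ρ, ⟨fun x => ?_, ?_⟩, ?_, ?_⟩
  · rw [hρ, hρi]
    split_ifs
    · rfl
    · rfl
    · exact hσ.1 x
  · rintro ⟨i, j, hij, h1, h2⟩
    exact hσ.2 ⟨i, j, hij, h1.trans_le (hle i), h2.trans_le (hle j)⟩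
  · simp [hρ, hEa]
  · simp [hρ, hE1 a hEa, (hE2 a).2 hEa]

theorem orbitOf_eq_pair {ρ : Equiv.Perm (Fin n)} {a b : Fin n} (hab : ρ a = b) (hba : ρ b = a) :
    orbitOf ρ a = {a, b} := by
  have h : ∀ m : ℕ, (ρ ^ m) a = a ∨ (ρ ^ m) a = b := by
    intro m
    induction m with
    | zero => exact Or.inl rfl
    | succ m ih =>
      rw [pow_succ', Equiv.Perm.mul_apply]
      rcases ih with h | h <;> simp [h, hab, hba]
  ext y
  simp only [orbitOf, Finset.mem_filter, Finset.mem_univ, true_and, Finset.mem_insert,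
    Finset.mem_singleton]
  constructor
  · intro hy
    obtain ⟨m, rfl⟩ := hy.exists_nat_pow_eq
    exact h m
  · rintro (rfl | rfl)
    · exact Equiv.Perm.SameCycle.refl _ _
    · exact hab ▸ Equiv.Perm.sameCycle_apply_right.2 (.refl _ _)

/-- Every non-reduced stable cycle has an arc `a → b` such that `{a, b}` supports a reduced
stable cycle. -/
theorem exists_arc_of_mem_diff {c : Finset (Fin n) × Equiv.Perm (Fin n)}
    (hc : c ∈ stableCycles I \ reducedStableCycles I) :
    ∃ (a b : Fin n) (q : Finset (Fin n) × Equiv.Perm (Fin n)) (σ : Equiv.Perm (Fin n)),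
      a ≠ b ∧ q ∈ reducedStableCycles I ∧ q.1 = {a, b} ∧ IsStablePartition I σ ∧ σ a = b ∧
      cycleAt σ a = c ∧ Even (orbitOf σ a).card ∧ (orbitOf σ a).card ≠ 2 := by
  obtain ⟨⟨σ, a, hσ, rfl⟩, hr⟩ := hc
  have hnot : ¬ ((orbitOf σ a).card = 2 ∨ Odd (orbitOf σ a).card) :=
    fun h => hr ⟨⟨σ, a, hσ, rfl⟩, h⟩
  rw [not_or, Nat.not_odd_iff_even] at hnot
  obtain ⟨htwo, heven⟩ := hnot
  have hne : a ≠ σ a := by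
    intro h
    have h1 := orbitOf_eq_pair (ρ := σ) (a := a) (b := a) h.symm h.symm
    rw [h1] at heven
    simp at heven
  obtain ⟨ρ, hρ, h1, h2⟩ := exists_isStablePartition_swap hσ heven
  have h3 : (cycleAt ρ a).1 = {a, σ a} := orbitOf_eq_pair h1 h2
  exact ⟨a, σ a, cycleAt ρ a, σ, hne,
    ⟨⟨ρ, a, hρ, rfl⟩, Or.inl (by rw [h3, Finset.card_pair hne])⟩, h3, hσ, rfl, rfl, heven, htwo⟩

theorem ncard_diff_reducedStableCycles_le (I : SRInstance n) :
    (stableCycles I \ reducedStableCycles I).ncard ≤ 2 * (reducedStableCycles I).ncard := by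
  rcases (stableCycles I \ reducedStableCycles I).eq_empty_or_nonempty with h0 | ⟨c₀, hc₀⟩
  · simp [h0]
  have : Nonempty (Fin n) := (exists_arc_of_mem_diff hc₀).nonempty
  choose! a b q σ hab hq hq1 hσ hσab hcyc heven htwo using
    fun c => exists_arc_of_mem_diff (I := I) (c := c)
  have h : (stableCycles I \ reducedStableCycles I).ncard ≤
      (reducedStableCycles I ×ˢ (Set.univ : Set Bool)).ncard := by
    refine Set.ncard_le_ncard_of_injOn (fun c => (q c, decide (a c < b c)))
      (fun c hc => ⟨hq c hc, Set.mem_univ _⟩) ?_ (Set.toFinite _)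
    intro c hc d hd hcd
    simp only [Prod.mk.injEq, decide_eq_decide] at hcd
    have hpair : ({a c, b c} : Finset (Fin n)) = {a d, b d} := by
      rw [← hq1 c hc, ← hq1 d hd, hcd.1]
    have hc1 := hab c hc
    have hd1 := hab d hd
    have m1 : a c ∈ ({a d, b d} : Finset (Fin n)) := by rw [← hpair]; simp
    have m2 : b c ∈ ({a d, b d} : Finset (Fin n)) := by rw [← hpair]; simp
    simp only [Finset.mem_insert, Finset.mem_singleton] at m1 m2
    have haa : a c = a d ∧ b c = b d := by
      have := hcd.2
      grind
    rw [← hcyc c hc, ← hcyc d hd, ← haa.1]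
    refine cycleAt_eq_of_apply_eq (hσ c hc) (hσ d hd) ?_ (heven c hc) (htwo c hc) ?_ ?_
    · rw [hσab c hc, haa.1, hσab d hd, haa.2]
    · rw [haa.1]
      exact heven d hd
    · rw [haa.1]
      exact htwo d hd
  rw [Set.ncard_prod] at h
  simp only [Set.ncard_univ, Nat.card_eq_fintype_card, Fintype.card_bool] at h
  omega

end SRInstance

/-- For any SR instance, `|RSC(I)| ≤ |SC(I)| ≤ 3 |RSC(I)|`. -/
theorem stable_cycles_vs_reduced {n : ℕ} (I : SRInstance n) :
    (reducedStableCycles I).ncard ≤ (stableCycles I).ncard ∧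
    (stableCycles I).ncard ≤ 3 * (reducedStableCycles I).ncard := by
  have hsub : reducedStableCycles I ⊆ stableCycles I := fun _ h => h.1
  refine ⟨Set.ncard_le_ncard hsub (Set.toFinite _), ?_⟩
  have h1 := Set.ncard_sdiff_add_ncard_of_subset hsub (Set.toFinite _)
  have h2 := I.ncard_diff_reducedStableCycles_le
  omega
end
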